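/- (Theorem 3, case g_ν) Let β > 0. Then there is a unique R ∈ (0, λ_0) such that Σ_{n≥0} 2R²/(λ_n² − R²) = β, and: (i) for every z ∈ ℂ with |z| < R one has |z Ψ'(z)/Ψ(z)| < β; (ii) at z = R one has |R Ψ'(R)/Ψ(R)| = β. (Since z g'(z)/g(z) − 1 = zΨ'(z)/Ψ(z) for g(z) = z Ψ(z), this says R is the largest radius on which the values of z g'(z)/g(z) lie in the disk {w : |w − 1| < β}, and hence the 𝒮*(φ)-radius of g for any Ma–Minda function φ whose image contains this disk with φ(−1) = 1 − β.) -/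

import Mathlib

open Real

/-- The entire function `Ψ(z) = ∏_{n≥0} (1 − z²/λ_n²)`. -/
noncomputable def PsiProd (l : ℕ → ℝ) (z : ℂ) : ℂ :=
  ∏' n : ℕ, (1 - z ^ 2 / ((l n : ℂ)) ^ 2)

lemma two_mul_sq_div_le_const_mul {a b x ρ : ℝ} (ha : 0 < a) (hab : a ≤ b) (hx : 0 ≤ x) (hxρ : x ≤ ρ)
    (hρ : ρ < a) :
    2 * x ^ 2 / (b ^ 2 - x ^ 2) ≤ 2 * ρ ^ 2 * a ^ 2 / (a ^ 2 - ρ ^ 2) * (1 / b ^ 2) := by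
  have h1 : x ^ 2 ≤ ρ ^ 2 := by gcongr
  have h2 : ρ ^ 2 < a ^ 2 := pow_lt_pow_left₀ hρ (hx.trans hxρ) two_ne_zero
  have h3 : a ^ 2 ≤ b ^ 2 := by gcongr
  have h4 : 0 < a ^ 2 := by positivity
  rw [div_mul_div_comm, mul_one, div_le_div_iff₀ (by linarith)
    (mul_pos (by linarith) (by linarith))]
  have h5 : (a ^ 2 - ρ ^ 2) * b ^ 2 ≤ a ^ 2 * (b ^ 2 - ρ ^ 2) := by
    nlinarith [mul_nonneg (sq_nonneg ρ) (sub_nonneg.2 h3)]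
  calc 2 * x ^ 2 * ((a ^ 2 - ρ ^ 2) * b ^ 2)
      ≤ 2 * ρ ^ 2 * (a ^ 2 * (b ^ 2 - x ^ 2)) := by
        refine mul_le_mul (by linarith) (h5.trans ?_) (mul_nonneg (by linarith) (by linarith))
          (by positivity)
        gcongr
    _ = 2 * ρ ^ 2 * a ^ 2 * (b ^ 2 - x ^ 2) := by ring

lemma two_mul_sq_div_lt {b x y : ℝ} (hx : 0 ≤ x) (hxy : x < y) (hy : y < b) :
    2 * x ^ 2 / (b ^ 2 - x ^ 2) < 2 * y ^ 2 / (b ^ 2 - y ^ 2) := by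
  have h1 : x ^ 2 < y ^ 2 := pow_lt_pow_left₀ hxy hx two_ne_zero
  have h2 : y ^ 2 < b ^ 2 := pow_lt_pow_left₀ hy (hx.trans hxy.le) two_ne_zero
  rw [div_lt_div_iff₀ (by linarith) (by linarith)]
  nlinarith [mul_pos (sub_pos.2 h1) (lt_of_le_of_lt (sq_nonneg y) h2)]

lemma norm_two_mul_sq_div_le {b : ℝ} {z : ℂ} (hz : ‖z‖ < b) :
    ‖2 * z ^ 2 / ((b : ℂ) ^ 2 - z ^ 2)‖ ≤ 2 * ‖z‖ ^ 2 / (b ^ 2 - ‖z‖ ^ 2) := by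
  have h2 : ‖z‖ ^ 2 < b ^ 2 := pow_lt_pow_left₀ hz (norm_nonneg z) two_ne_zero
  rw [norm_div, norm_mul, norm_pow, Complex.norm_two]
  have h3 := norm_sub_norm_le ((b : ℂ) ^ 2) (z ^ 2)
  simp only [norm_pow, Complex.norm_real, Real.norm_eq_abs, sq_abs] at h3
  exact div_le_div_of_nonneg_left (by positivity) (by linarith) h3

section

variable {l : ℕ → ℝ}

lemma summable_two_mul_sq_div (hmono : StrictMono l) (hpos : ∀ n, 0 < l n)
    (hsum : Summable fun n => 1 / (l n) ^ 2) {x : ℝ} (hx : 0 ≤ x) (hxl : x < l 0) :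
    Summable fun n => 2 * x ^ 2 / ((l n) ^ 2 - x ^ 2) := by
  refine Summable.of_nonneg_of_le (fun n => ?_)
    (fun n => two_mul_sq_div_le_const_mul (hpos 0) (hmono.monotone n.zero_le) hx le_rfl hxl)
    (hsum.mul_left _)
  have := pow_lt_pow_left₀ (hxl.trans_le (hmono.monotone n.zero_le)) hx two_ne_zero
  exact div_nonneg (by positivity) (by linarith)

lemma tsum_two_mul_sq_div_lt (hmono : StrictMono l) (hpos : ∀ n, 0 < l n)
    (hsum : Summable fun n => 1 / (l n) ^ 2) {x y : ℝ} (hx : 0 ≤ x) (hxy : x < y)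
    (hy : y < l 0) :
    ∑' n, 2 * x ^ 2 / ((l n) ^ 2 - x ^ 2) < ∑' n, 2 * y ^ 2 / ((l n) ^ 2 - y ^ 2) := by
  have key n := two_mul_sq_div_lt hx hxy (hy.trans_le (hmono.monotone (Nat.zero_le n)))
  exact Summable.tsum_lt_tsum (fun n => (key n).le) (key 0)
    (summable_two_mul_sq_div hmono hpos hsum hx (hxy.trans hy))
    (summable_two_mul_sq_div hmono hpos hsum (hx.trans hxy.le) hy)

lemma exists_tsum_two_mul_sq_div_eq (hmono : StrictMono l) (hpos : ∀ n, 0 < l n)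
    (hsum : Summable fun n => 1 / (l n) ^ 2) {β : ℝ} (hβ : 0 < β) :
    ∃ R ∈ Set.Ioo 0 (l 0), ∑' n, 2 * R ^ 2 / ((l n) ^ 2 - R ^ 2) = β := by
  have h0 := hpos 0
  obtain ⟨ρ, hρ0, hρl, hρ⟩ : ∃ ρ, 0 ≤ ρ ∧ ρ < l 0 ∧
      2 * ρ ^ 2 / ((l 0) ^ 2 - ρ ^ 2) = β := by
    have hs : √(β / (2 + β)) ^ 2 = β / (2 + β) := Real.sq_sqrt (by positivity)
    have hlt : √(β / (2 + β)) < 1 := by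
      rw [Real.sqrt_lt' one_pos, one_pow, div_lt_one (by positivity)]
      linarith
    refine ⟨l 0 * √(β / (2 + β)), by positivity, by nlinarith, ?_⟩
    rw [mul_pow, hs]
    have : l 0 ^ 2 - l 0 ^ 2 * (β / (2 + β)) = 2 * l 0 ^ 2 / (2 + β) := by
      field_simp
      ring
    rw [this]
    field_simp
  have hcont : ContinuousOn (fun x => ∑' n, 2 * x ^ 2 / ((l n) ^ 2 - x ^ 2)) (Set.Icc 0 ρ) := by
    have hlt n (x : ℝ) (hx : x ∈ Set.Icc 0 ρ) : 0 < l n ^ 2 - x ^ 2 := by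
      have := pow_lt_pow_left₀ ((hx.2.trans_lt hρl).trans_le (hmono.monotone (Nat.zero_le n)))
        hx.1 two_ne_zero
      linarith
    refine continuousOn_tsum (fun n => ?_) (hsum.mul_left _) (fun n x hx => ?_)
      (u := fun n => 2 * ρ ^ 2 * l 0 ^ 2 / (l 0 ^ 2 - ρ ^ 2) * (1 / l n ^ 2))
    · exact ContinuousOn.div (by fun_prop) (by fun_prop) fun x hx => (hlt n x hx).ne'
    · rw [Real.norm_of_nonneg (div_nonneg (by positivity) (hlt n x hx).le)]
      exact two_mul_sq_div_le_const_mul h0 (hmono.monotone n.zero_le) hx.1 hx.2 hρl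
  have hge : β ≤ ∑' n, 2 * ρ ^ 2 / ((l n) ^ 2 - ρ ^ 2) := by
    rw [← hρ]
    refine (summable_two_mul_sq_div hmono hpos hsum hρ0 hρl).le_tsum 0 fun n _ => ?_
    have := pow_lt_pow_left₀ (hρl.trans_le (hmono.monotone n.zero_le)) hρ0 two_ne_zero
    exact div_nonneg (by positivity) (by linarith)
  obtain ⟨R, hR, hRβ⟩ := intermediate_value_Icc hρ0 hcont ⟨by simpa using hβ.le, hge⟩
  refine ⟨R, ⟨hR.1.lt_of_ne ?_, hR.2.trans_lt hρl⟩, hRβ⟩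
  rintro rfl
  simp at hRβ
  exact hβ.ne hRβ

lemma mul_deriv_PsiProd_div (hmono : StrictMono l) (hpos : ∀ n, 0 < l n)
    (hsum : Summable fun n => 1 / (l n) ^ 2) {z : ℂ} (hz : ‖z‖ < l 0) :
    z * deriv (PsiProd l) z / PsiProd l z
      = -∑' n, 2 * z ^ 2 / ((l n : ℂ) ^ 2 - z ^ 2) := by
  have hl n : (l n : ℂ) ^ 2 ≠ 0 := pow_ne_zero 2 (Complex.ofReal_ne_zero.2 (hpos n).ne')
  have hsub n : (l n : ℂ) ^ 2 - z ^ 2 ≠ 0 := by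
    intro h
    have h1 : ‖(l n : ℂ) ^ 2‖ = ‖z ^ 2‖ := by rw [sub_eq_zero.1 h]
    have h2 := pow_lt_pow_left₀ (hz.trans_le (hmono.monotone (Nat.zero_le n))) (norm_nonneg z)
      two_ne_zero
    simp at h1
    linarith
  have hfac n : 1 - z ^ 2 / (l n : ℂ) ^ 2 ≠ 0 := by
    rw [one_sub_div (hl n)]
    exact div_ne_zero (hsub n) (hl n)
  have hterm n : z * logDeriv (fun w : ℂ => 1 - w ^ 2 / (l n : ℂ) ^ 2) z
      = -(2 * z ^ 2 / ((l n : ℂ) ^ 2 - z ^ 2)) := by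
    have hd : HasDerivAt (fun w : ℂ => 1 - w ^ 2 / (l n : ℂ) ^ 2)
        (-(2 * z / (l n : ℂ) ^ 2)) z := by
      simpa using ((hasDerivAt_pow 2 z).div_const ((l n : ℂ) ^ 2)).const_sub 1
    rw [logDeriv_apply, hd.deriv, one_sub_div (hl n)]
    have : (l n : ℂ) ≠ 0 := Complex.ofReal_ne_zero.2 (hpos n).ne'
    have := hsub n
    field_simp
  have hS : Summable fun n => 2 * z ^ 2 / ((l n : ℂ) ^ 2 - z ^ 2) :=
    .of_norm_bounded (summable_two_mul_sq_div hmono hpos hsum (norm_nonneg z) hz)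
      fun n => norm_two_mul_sq_div_le (hz.trans_le (hmono.monotone n.zero_le))
  have hlog : Summable fun n => logDeriv (fun w : ℂ => 1 - w ^ 2 / (l n : ℂ) ^ 2) z := by
    rcases eq_or_ne z 0 with rfl | hz0
    · simp [logDeriv_apply, summable_zero]
    · rw [← summable_mul_left_iff hz0]
      simpa only [hterm] using hS.neg
  have hbd (w : ℂ) n : ‖-(w ^ 2 / (l n : ℂ) ^ 2)‖ = ‖w‖ ^ 2 * (1 / l n ^ 2) := by
    simp [div_eq_mul_inv]
  have hmul : MultipliableLocallyUniformlyOn (fun n (w : ℂ) => 1 - w ^ 2 / (l n : ℂ) ^ 2)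
      (Metric.ball 0 (l 0)) := by
    simp_rw [sub_eq_add_neg]
    refine (hsum.mul_left (l 0 ^ 2)).multipliableLocallyUniformlyOn_one_add Metric.isOpen_ball
      (.of_forall fun n w hw => ?_) fun n => by fun_prop
    rw [hbd]
    gcongr
    exact (mem_ball_zero_iff.1 hw).le
  have hne : ∏' n, (1 - z ^ 2 / (l n : ℂ) ^ 2) ≠ 0 := by
    simp_rw [sub_eq_add_neg] at hfac ⊢
    refine tprod_one_add_ne_zero_of_summable hfac ?_
    simp_rw [hbd]
    exact hsum.mul_left _
  have key := logDeriv_tprod_eq_tsum Metric.isOpen_ball (mem_ball_zero_iff.2 hz) hfac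
    (fun n => by fun_prop) hlog hmul hne
  change logDeriv (PsiProd l) z = _ at key
  rw [mul_div_assoc, ← logDeriv_apply, key, ← tsum_mul_left, ← tsum_neg]
  exact tsum_congr hterm

lemma norm_mul_deriv_PsiProd_div_le (hmono : StrictMono l) (hpos : ∀ n, 0 < l n)
    (hsum : Summable fun n => 1 / (l n) ^ 2) {z : ℂ} (hz : ‖z‖ < l 0) :
    ‖z * deriv (PsiProd l) z / PsiProd l z‖ ≤ ∑' n, 2 * ‖z‖ ^ 2 / ((l n) ^ 2 - ‖z‖ ^ 2) := by
  rw [mul_deriv_PsiProd_div hmono hpos hsum hz, norm_neg]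
  exact tsum_of_norm_bounded
    (summable_two_mul_sq_div hmono hpos hsum (norm_nonneg z) hz).hasSum
    fun n => norm_two_mul_sq_div_le (hz.trans_le (hmono.monotone n.zero_le))

end

theorem stmt_15 (l : ℕ → ℝ) (hmono : StrictMono l) (hpos : ∀ n, 0 < l n)
    (hsum : Summable fun n => 1 / (l n) ^ 2) (β : ℝ) (hβ : 0 < β) :
    ∃ R : ℝ, R ∈ Set.Ioo 0 (l 0) ∧
      (∑' n : ℕ, 2 * R ^ 2 / ((l n) ^ 2 - R ^ 2) = β) ∧
      (∀ S ∈ Set.Ioo (0 : ℝ) (l 0),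
        (∑' n : ℕ, 2 * S ^ 2 / ((l n) ^ 2 - S ^ 2) = β) → S = R) ∧
      (∀ z : ℂ, ‖z‖ < R →
        ‖z * deriv (PsiProd l) z / PsiProd l z‖ < β) ∧
      ‖(R : ℂ) * deriv (PsiProd l) R / PsiProd l R‖ = β := by
  obtain ⟨R, hR, hRβ⟩ := exists_tsum_two_mul_sq_div_eq hmono hpos hsum hβ
  refine ⟨R, hR, hRβ, fun S hS hSβ => ?_, fun z hz => ?_, ?_⟩
  · rcases lt_trichotomy S R with h | h | h
    · have := tsum_two_mul_sq_div_lt hmono hpos hsum hS.1.le h hR.2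
      linarith
    · exact h
    · have := tsum_two_mul_sq_div_lt hmono hpos hsum hR.1.le h hS.2
      linarith
  · calc _ ≤ _ := norm_mul_deriv_PsiProd_div_le hmono hpos hsum (hz.trans hR.2)
      _ < _ := tsum_two_mul_sq_div_lt hmono hpos hsum (norm_nonneg z) hz hR.2
      _ = β := hRβ
  · have hz : ‖(R : ℂ)‖ < l 0 := by
      rw [Complex.norm_real, Real.norm_of_nonneg hR.1.le]
      exact hR.2
    rw [mul_deriv_PsiProd_div hmono hpos hsum hz, norm_neg]
    have : ∑' n, 2 * (R : ℂ) ^ 2 / ((l n : ℂ) ^ 2 - (R : ℂ) ^ 2) = (β : ℂ) := by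
      rw [← hRβ, Complex.ofReal_tsum]
      push_cast
      rfl
    rw [this, Complex.norm_real, Real.norm_of_nonneg hβ.le]
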